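/- A poset P is quasiexact provided that for every nonempty subset H ⊆ P and every x ∈ P with H ≪_w x there exists a finite nonempty subset F ⊆ ↑H with F ≪_w x. -/

import Mathlib

open Set TopologicalSpace

variable {α : Type*}

/-- The upper closure `↑A = {p : ∃ a ∈ A, a ≤ p}`. -/
def upSet [PartialOrder α] (A : Set α) : Set α := {p | ∃ a ∈ A, a ≤ p}

/-- The lower closure `↓A = {p : ∃ a ∈ A, p ≤ a}`. -/
def downSet [PartialOrder α] (A : Set α) : Set α := {p | ∃ a ∈ A, p ≤ a}

/-- A nonempty subset `D` is directed if every two elements have an upper bound in `D`. -/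
def IsDirectedSet [PartialOrder α] (D : Set α) : Prop :=
  D.Nonempty ∧ ∀ a ∈ D, ∀ b ∈ D, ∃ c ∈ D, a ≤ c ∧ b ≤ c

/-- `G` is weakly way below `H` (`G ≪_w H`): for every directed `D` whose sup exists,
`sup D ∈ H` implies `d ∈ ↑G` for some `d ∈ D`. -/
def WWB [PartialOrder α] (G H : Set α) : Prop :=
  ∀ D : Set α, IsDirectedSet D → ∀ s : α, IsLUB D s → s ∈ H → ∃ d ∈ D, d ∈ upSet G

/-- `↟_w G = {a : G ≪_w a}`. -/
def wUp [PartialOrder α] (G : Set α) : Set α := {a | WWB G {a}}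

/-- `fin_w(x)`: all finite nonempty subsets `F` with `F ≪_w x`. -/
def finW [PartialOrder α] (x : α) : Set (Set α) :=
  {F | F.Finite ∧ F.Nonempty ∧ WWB F {x}}

/-- `fin_(bl)w(x) = {F ∈ fin_w(x) : F ⊆ ↓x}`. -/
def finBlW [PartialOrder α] (x : α) : Set (Set α) :=
  {F | F ∈ finW x ∧ F ⊆ downSet {x}}

/-- A family `𝓕` of subsets is directed if for `F₁, F₂ ∈ 𝓕` there is `F₃ ∈ 𝓕`
with `F₃ ⊆ ↑F₁ ∩ ↑F₂`. -/
def DirectedFam [PartialOrder α] (𝓕 : Set (Set α)) : Prop :=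
  ∀ F₁ ∈ 𝓕, ∀ F₂ ∈ 𝓕, ∃ F₃ ∈ 𝓕, F₃ ⊆ upSet F₁ ∩ upSet F₂

/-- `P` is quasiexact if for each `x` the family `fin_w(x)` is directed and
`⋂ {↑F : F ∈ fin_w(x)} = ↑x`. -/
def Quasiexact (α : Type*) [PartialOrder α] : Prop :=
  ∀ x : α, DirectedFam (finW x) ∧ (⋂ F ∈ finW x, upSet F) = upSet {x}

/-- A dcpo: every directed subset has a supremum. -/
def IsDcpo (α : Type*) [PartialOrder α] : Prop :=
  ∀ D : Set α, IsDirectedSet D → ∃ s : α, IsLUB D s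

/-- The wf topology: generated by the subbasis `{↟_w F : F finite nonempty}`. -/
def wfTopology (α : Type*) [PartialOrder α] : TopologicalSpace α :=
  generateFrom {U | ∃ F : Set α, F.Finite ∧ F.Nonempty ∧ U = wUp F}

/-- The wwb topology: generated by the subbasis `{↟_w x : x ∈ P}`. -/
def wwbTopology (α : Type*) [PartialOrder α] : TopologicalSpace α :=
  generateFrom {U | ∃ x : α, U = wUp {x}}

/-- `P` is moderately meet continuous: `x ≤ sup D` implies
`x ∈ cl_{τ_wf}(↓D ∩ ↓x)` for every directed `D` whose sup exists. -/
def ModMeetCont (α : Type*) [PartialOrder α] : Prop :=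
  ∀ x : α, ∀ D : Set α, IsDirectedSet D → ∀ s : α, IsLUB D s → x ≤ s →
    x ∈ @closure α (wfTopology α) (downSet D ∩ downSet {x})

/-- `U` is Scott open: `U = ↑U` and every directed set whose sup lies in `U` meets `U`. -/
def IsScottOpen [PartialOrder α] (U : Set α) : Prop :=
  upSet U = U ∧
    ∀ D : Set α, IsDirectedSet D → ∀ s : α, IsLUB D s → s ∈ U → (D ∩ U).Nonempty

/-- The Scott topology. -/
def scottTopology (α : Type*) [PartialOrder α] : TopologicalSpace α :=
  generateFrom {U | IsScottOpen U}

/-- `P` is exact: for every `x` the set `{y : y ≪_w x}` is directed with supremum `x`. -/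
def ExactPoset (α : Type*) [PartialOrder α] : Prop :=
  ∀ x : α, IsDirectedSet {y | WWB {y} {x}} ∧ IsLUB {y | WWB {y} {x}} x

/-- `x` is way below `y`: for every directed `D` whose sup exists,
`y ≤ sup D` implies `x ≤ d` for some `d ∈ D`. -/
def WayBelowPt [PartialOrder α] (x y : α) : Prop :=
  ∀ D : Set α, IsDirectedSet D → ∀ s : α, IsLUB D s → y ≤ s → ∃ d ∈ D, x ≤ d

/-- `G` is way below `H`: for every directed `D` whose sup exists,
`sup D ∈ ↑H` implies `d ∈ ↑G` for some `d ∈ D`. -/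
def WayBelowSet [PartialOrder α] (G H : Set α) : Prop :=
  ∀ D : Set α, IsDirectedSet D → ∀ s : α, IsLUB D s → s ∈ upSet H → ∃ d ∈ D, d ∈ upSet G

/-- `fin(x)`: all finite nonempty subsets `F` with `F ≪ x`. -/
def finWB [PartialOrder α] (x : α) : Set (Set α) :=
  {F | F.Finite ∧ F.Nonempty ∧ WayBelowSet F {x}}

/-- The relation `≪_w` is weakly increasing: `x ≪_w y ≤ z ≪_w u` implies `x ≪_w z`. -/
def WeaklyIncreasing (α : Type*) [PartialOrder α] : Prop :=
  ∀ x y z u : α, WWB {x} {y} → y ≤ z → WWB {z} {u} → WWB {x} {z}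

lemma upSet_upSet_subset [PartialOrder α] (A : Set α) : upSet (upSet A) ⊆ upSet A := by
  rintro z ⟨b, ⟨a, ha, hab⟩, hbz⟩
  exact ⟨a, ha, hab.trans hbz⟩

lemma upSet_mono [PartialOrder α] {A B : Set α} (hAB : A ⊆ B) : upSet A ⊆ upSet B :=
  fun _ ⟨a, ha, haz⟩ => ⟨a, hAB ha, haz⟩

lemma subset_upSet [PartialOrder α] (A : Set α) : A ⊆ upSet A :=
  fun a ha => ⟨a, ha, le_rfl⟩

lemma WWB.mem_upSet [PartialOrder α] {G : Set α} {x : α} (hG : WWB G {x}) : x ∈ upSet G := by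
  obtain ⟨d, rfl, hd⟩ := hG {x} ⟨singleton_nonempty x, by simp⟩ x isLUB_singleton rfl
  exact hd

lemma WWB.inter_upSet [PartialOrder α] {F G H : Set α} (hF : WWB F H) (hG : WWB G H) :
    WWB (upSet F ∩ upSet G) H := by
  intro D hD s hs hsH
  obtain ⟨d, hd, hdF⟩ := hF D hD s hs hsH
  obtain ⟨e, he, heG⟩ := hG D hD s hs hsH
  obtain ⟨c, hc, hdc, hec⟩ := hD.2 d hd e he
  exact ⟨c, hc, subset_upSet _
    ⟨upSet_upSet_subset F ⟨d, hdF, hdc⟩, upSet_upSet_subset G ⟨e, heG, hec⟩⟩⟩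

lemma wwb_setOf_not_le [PartialOrder α] {x y : α} (hxy : ¬ x ≤ y) : WWB {z | ¬ z ≤ y} {x} := by
  rintro D - s hs rfl
  by_contra hD
  exact hxy (hs.2 fun d hd => by_contra fun hdy => hD ⟨d, hd, subset_upSet _ hdy⟩)

/-- A poset is quasiexact provided whenever `H ≪_w x` for nonempty
`H`, there is a finite nonempty `F ⊆ ↑H` with `F ≪_w x`. -/
theorem quasiexact_of_finite_interpolation [PartialOrder α]
    (h : ∀ H : Set α, H.Nonempty → ∀ x : α, WWB H {x} →
      ∃ F : Set α, F.Finite ∧ F.Nonempty ∧ F ⊆ upSet H ∧ WWB F {x}) :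
    Quasiexact α := by
  intro x
  refine ⟨?_, Subset.antisymm ?_ ?_⟩
  · rintro F₁ ⟨-, -, h₁⟩ F₂ ⟨-, -, h₂⟩
    obtain ⟨F, hfin, hne, hsub, hF⟩ :=
      h (upSet F₁ ∩ upSet F₂) ⟨x, h₁.mem_upSet, h₂.mem_upSet⟩ x (h₁.inter_upSet h₂)
    refine ⟨F, ⟨hfin, hne, hF⟩, hsub.trans (subset_inter ?_ ?_)⟩
    · exact (upSet_mono inter_subset_left).trans (upSet_upSet_subset F₁)
    · exact (upSet_mono inter_subset_right).trans (upSet_upSet_subset F₂)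
  · intro y hy
    refine ⟨x, rfl, by_contra fun hxy => ?_⟩
    obtain ⟨F, hfin, hne, hsub, hF⟩ := h {z | ¬ z ≤ y} ⟨x, hxy⟩ x (wwb_setOf_not_le hxy)
    obtain ⟨a, ha, hay⟩ := mem_iInter₂.mp hy F ⟨hfin, hne, hF⟩
    obtain ⟨b, hb, hba⟩ := hsub ha
    exact hb (hba.trans hay)
  · rintro y ⟨_, rfl, hxy⟩
    exact mem_iInter₂.mpr fun F hF => upSet_upSet_subset F ⟨_, hF.2.2.mem_upSet, hxy⟩
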